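/- Let n be a positive integer, ρ a density matrix on R⊗A, and σ a density matrix on A. For each x ∈ {1,…,n} let τ_x = ρ^{RA_x} ⊗ (⊗_{i≠x} σ^{A_i}) on R⊗A₁⊗…⊗A_n (each A_i a copy of A), let τ = (1/n) Σ_{x=1}^n τ_x, and set ν_n := min over density matrices ω on R of [((n−1)/n)·Q₂(ρ^R ‖ ω) + (1/n)·Q₂(ρ^{RA} ‖ ω ⊗ σ)], where ρ^R = Tr_A ρ. Then P²(τ, ρ^R ⊗ σ^{⊗n}) ≤ 1 − 1/ν_n. -/

import Mathlib

open scoped Matrix Kronecker BigOperators ENNReal ComplexOrder Classical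

noncomputable section

variable {d : Type*} [Fintype d] [DecidableEq d]

/-- Apply a real function to the eigenvalues of a Hermitian matrix (spectral
functional calculus). -/
def herFun {A : Matrix d d ℂ} (hA : A.IsHermitian) (f : ℝ → ℝ) : Matrix d d ℂ :=
  (hA.eigenvectorUnitary : Matrix d d ℂ) *
    Matrix.diagonal (fun i => (f (hA.eigenvalues i) : ℂ)) *
    (hA.eigenvectorUnitary : Matrix d d ℂ)ᴴ

/-- Functional calculus, extended by the junk value `0` to non-Hermitian matrices. -/
def matFun (A : Matrix d d ℂ) (f : ℝ → ℝ) : Matrix d d ℂ :=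
  if h : A.IsHermitian then herFun h f else 0

/-- Real power of a Hermitian matrix, taken on its support (Moore–Penrose
convention: zero eigenvalues are sent to zero; negative powers are pseudo-inverses). -/
def matPow (A : Matrix d d ℂ) (r : ℝ) : Matrix d d ℂ :=
  matFun A (fun x => if x = 0 then 0 else Real.rpow x r)

/-- Logarithm of a Hermitian matrix on its support. -/
def matLog (A : Matrix d d ℂ) : Matrix d d ℂ := matFun A Real.log

/-- A density matrix: positive semidefinite with unit trace. -/
def IsDensity (A : Matrix d d ℂ) : Prop := A.PosSemidef ∧ A.trace = 1

/-- `suppLE ρ σ` : the support of `ρ` is contained in the support of `σ`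
(for Hermitian matrices this is equivalent to `ker σ ≤ ker ρ`). -/
def suppLE (ρ σ : Matrix d d ℂ) : Prop :=
  LinearMap.ker σ.mulVecLin ≤ LinearMap.ker ρ.mulVecLin

/-- Trace (nuclear) norm of a matrix: `Tr √(AᴴA)`. -/
def traceNorm (A : Matrix d d ℂ) : ℝ := (Matrix.trace (matPow (Aᴴ * A) (1/2))).re

/-- The real-valued collision quantity `Tr[ρ σ^{-1/2} ρ σ^{-1/2}]`. -/
def Q2R (ρ σ : Matrix d d ℂ) : ℝ :=
  (Matrix.trace (ρ * matPow σ (-(1/2)) * ρ * matPow σ (-(1/2)))).re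

/-- `Q₂(ρ‖σ) = Tr[ρ σ^{-1/2} ρ σ^{-1/2}]`, equal to `+∞` unless `supp ρ ⊆ supp σ`. -/
def Q2 (ρ σ : Matrix d d ℂ) : ℝ≥0∞ :=
  if suppLE ρ σ then ENNReal.ofReal (Q2R ρ σ) else ∞

/-- Collision relative entropy `D₂(ρ‖σ) = log Q₂(ρ‖σ)`. -/
def D2 (ρ σ : Matrix d d ℂ) : EReal := ENNReal.log (Q2 ρ σ)

/-- Fidelity `F(ρ,σ) = ‖√ρ √σ‖₁`. -/
def fidelity (ρ σ : Matrix d d ℂ) : ℝ := traceNorm (matPow ρ (1/2) * matPow σ (1/2))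

/-- Purified distance `P(ρ,σ) = √(1 - F(ρ,σ)²)`. -/
def purifiedDist (ρ σ : Matrix d d ℂ) : ℝ := Real.sqrt (1 - fidelity ρ σ ^ 2)

variable {R A : Type*} [Fintype R] [DecidableEq R] [Fintype A] [DecidableEq A]

/-- Partial trace over the second tensor factor. -/
def ptrace2 (ρ : Matrix (R × A) (R × A) ℂ) : Matrix R R ℂ :=
  Matrix.of fun i j => ∑ a : A, ρ (i, a) (j, a)

/-- `n`-fold tensor power `σ^{⊗n}` of a matrix `σ`. -/
def tpow (σ : Matrix A A ℂ) (n : ℕ) : Matrix (Fin n → A) (Fin n → A) ℂ :=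
  Matrix.of fun v w => ∏ k, σ (v k) (w k)

/-- The state `τ_x = ρ^{R A_x} ⊗ (⊗_{i ≠ x} σ^{A_i})` on `R ⊗ A₁ ⊗ ⋯ ⊗ A_n`. -/
def tauX (ρ : Matrix (R × A) (R × A) ℂ) (σ : Matrix A A ℂ) (n : ℕ) (x : Fin n) :
    Matrix (R × (Fin n → A)) (R × (Fin n → A)) ℂ :=
  Matrix.of fun p q =>
    ρ (p.1, p.2 x) (q.1, q.2 x) * ∏ k ∈ Finset.univ.erase x, σ (p.2 k) (q.2 k)

set_option linter.unusedSectionVars false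

/-! ### Functional calculus helpers -/

lemma herFun_conjT {M : Matrix d d ℂ} (h : M.IsHermitian) (f : ℝ → ℝ) :
    (herFun h f)ᴴ = herFun h f := by
  unfold herFun
  rw [Matrix.conjTranspose_mul, Matrix.conjTranspose_mul, Matrix.conjTranspose_conjTranspose,
    Matrix.diagonal_conjTranspose, Matrix.mul_assoc]
  congr 3
  ext i
  simp

lemma herFun_mul {M : Matrix d d ℂ} (h : M.IsHermitian) (f g : ℝ → ℝ) :
    herFun h f * herFun h g = herFun h (fun x => f x * g x) := by
  unfold herFun
  have hU : (h.eigenvectorUnitary : Matrix d d ℂ)ᴴ * (h.eigenvectorUnitary : Matrix d d ℂ) = 1 :=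
    Unitary.coe_star_mul_self h.eigenvectorUnitary
  set U := (h.eigenvectorUnitary : Matrix d d ℂ)
  calc U * Matrix.diagonal (fun i => (f (h.eigenvalues i) : ℂ)) * Uᴴ *
        (U * Matrix.diagonal (fun i => (g (h.eigenvalues i) : ℂ)) * Uᴴ)
      = U * Matrix.diagonal (fun i => (f (h.eigenvalues i) : ℂ)) * (Uᴴ * U) *
        Matrix.diagonal (fun i => (g (h.eigenvalues i) : ℂ)) * Uᴴ := by
          simp only [Matrix.mul_assoc]
    _ = _ := by
          rw [hU, Matrix.mul_one, Matrix.mul_assoc U, Matrix.diagonal_mul_diagonal]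
          simp

lemma herFun_congr {M : Matrix d d ℂ} (h : M.IsHermitian) (f g : ℝ → ℝ)
    (hfg : ∀ i, f (h.eigenvalues i) = g (h.eigenvalues i)) : herFun h f = herFun h g := by
  unfold herFun
  simp only [hfg]

lemma herFun_id {M : Matrix d d ℂ} (h : M.IsHermitian) : herFun h (fun x => x) = M := by
  conv_rhs => rw [h.spectral_theorem]
  rfl

/-- The spectral functional calculus does not depend on the diagonalization. -/
lemma herFun_unique {M : Matrix d d ℂ} (h : M.IsHermitian) (f : ℝ → ℝ) (U : Matrix d d ℂ)
    (e : d → ℝ) (hU : U * Uᴴ = 1) (hM : M = U * Matrix.diagonal (fun i => (e i : ℂ)) * Uᴴ) :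
    herFun h f = U * Matrix.diagonal (fun i => (f (e i) : ℂ)) * Uᴴ := by
  have hU' : Uᴴ * U = 1 := mul_eq_one_comm.mp hU
  have hV : (h.eigenvectorUnitary : Matrix d d ℂ)ᴴ * (h.eigenvectorUnitary : Matrix d d ℂ) = 1 :=
    Unitary.coe_star_mul_self h.eigenvectorUnitary
  have hM2 := herFun_id h
  unfold herFun at hM2 ⊢
  set V := (h.eigenvectorUnitary : Matrix d d ℂ)
  have hV' : V * Vᴴ = 1 := mul_eq_one_comm.mp hV
  have key : Matrix.diagonal (fun i => (h.eigenvalues i : ℂ)) * (Vᴴ * U)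
      = (Vᴴ * U) * Matrix.diagonal (fun i => (e i : ℂ)) := by
    have h1 : Vᴴ * M * U = Matrix.diagonal (fun i => (h.eigenvalues i : ℂ)) * (Vᴴ * U) := by
      conv_lhs => rw [← hM2]
      simp only [← Matrix.mul_assoc]
      rw [hV, Matrix.one_mul]
    have h2 : Vᴴ * M * U = (Vᴴ * U) * Matrix.diagonal (fun i => (e i : ℂ)) := by
      conv_lhs => rw [hM]
      simp only [Matrix.mul_assoc]
      rw [hU', Matrix.mul_one]
    rw [← h1, h2]
  have key2 : Matrix.diagonal (fun i => (f (h.eigenvalues i) : ℂ)) * (Vᴴ * U)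
      = (Vᴴ * U) * Matrix.diagonal (fun i => (f (e i) : ℂ)) := by
    ext i j
    have hk := congrFun (congrFun key i) j
    rw [Matrix.diagonal_mul, Matrix.mul_diagonal] at hk ⊢
    by_cases hz : (Vᴴ * U) i j = 0
    · rw [hz]; simp
    · rw [mul_comm] at hk
      have := mul_left_cancel₀ hz hk
      have h3 : h.eigenvalues i = e j := by exact_mod_cast this
      rw [h3, mul_comm]
  calc V * Matrix.diagonal (fun i => (f (h.eigenvalues i) : ℂ)) * Vᴴ
      = V * (Matrix.diagonal (fun i => (f (h.eigenvalues i) : ℂ)) * (Vᴴ * U)) * Uᴴ := by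
        simp only [Matrix.mul_assoc]
        rw [hU, Matrix.mul_one]
    _ = (V * Vᴴ) * U * Matrix.diagonal (fun i => (f (e i) : ℂ)) * Uᴴ := by
        rw [key2]; simp only [Matrix.mul_assoc]
    _ = _ := by rw [hV', Matrix.one_mul]

lemma mp_herm (M : Matrix d d ℂ) (r : ℝ) : (matPow M r)ᴴ = matPow M r := by
  unfold matPow matFun
  split_ifs with h
  · exact herFun_conjT h _
  · simp

lemma mp_mul {M : Matrix d d ℂ} (hM : M.PosSemidef) (a b : ℝ) :
    matPow M a * matPow M b = matPow M (a + b) := by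
  unfold matPow matFun
  rw [dif_pos hM.1, dif_pos hM.1, dif_pos hM.1, herFun_mul]
  apply herFun_congr
  intro i
  have h0 := hM.eigenvalues_nonneg i
  by_cases hz : hM.1.eigenvalues i = 0
  · simp [hz]
  · simp only [hz, if_false]
    exact (Real.rpow_add (lt_of_le_of_ne h0 (Ne.symm hz)) a b).symm

lemma mp_one {M : Matrix d d ℂ} (hM : M.PosSemidef) : matPow M 1 = M := by
  conv_rhs => rw [← herFun_id hM.1]
  unfold matPow matFun
  rw [dif_pos hM.1]
  apply herFun_congr
  intro i
  by_cases hz : hM.1.eigenvalues i = 0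
  · simp [hz]
  · simp only [hz, if_false]
    exact Real.rpow_one _

/-- Powers of Kronecker products. -/
lemma mp_kron {d' : Type*} [Fintype d'] [DecidableEq d'] {M : Matrix d d ℂ} {N : Matrix d' d' ℂ}
    (hM : M.PosSemidef) (hN : N.PosSemidef) (r : ℝ) :
    matPow (M ⊗ₖ N) r = matPow M r ⊗ₖ matPow N r := by
  have hMN : (M ⊗ₖ N).IsHermitian := by
    unfold Matrix.IsHermitian
    rw [Matrix.conjTranspose_kronecker, hM.1, hN.1]
  unfold matPow matFun
  rw [dif_pos hM.1, dif_pos hN.1, dif_pos hMN]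
  have hU : (hM.1.eigenvectorUnitary : Matrix d d ℂ) * (hM.1.eigenvectorUnitary : Matrix d d ℂ)ᴴ
    = 1 := Unitary.coe_mul_star_self hM.1.eigenvectorUnitary
  have hV : (hN.1.eigenvectorUnitary : Matrix d' d' ℂ) *
    (hN.1.eigenvectorUnitary : Matrix d' d' ℂ)ᴴ
    = 1 := Unitary.coe_mul_star_self hN.1.eigenvectorUnitary
  have hM2 := herFun_id hM.1
  have hN2 := herFun_id hN.1
  have e1 := hM.eigenvalues_nonneg
  have e2 := hN.eigenvalues_nonneg
  unfold herFun at hM2 hN2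
  rw [herFun_unique hMN _
    ((hM.1.eigenvectorUnitary : Matrix d d ℂ) ⊗ₖ (hN.1.eigenvectorUnitary : Matrix d' d' ℂ))
    (fun p => hM.1.eigenvalues p.1 * hN.1.eigenvalues p.2)]
  · unfold herFun
    rw [Matrix.mul_kronecker_mul, Matrix.mul_kronecker_mul, Matrix.conjTranspose_kronecker,
      Matrix.diagonal_kronecker_diagonal]
    congr 3
    ext p
    by_cases h1 : hM.1.eigenvalues p.1 = 0
    · simp [h1]
    · by_cases h2 : hN.1.eigenvalues p.2 = 0
      · simp [h2]
      · simp only [h1, h2, mul_eq_zero, or_self, if_false]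
        rw [← Complex.ofReal_mul]
        congr 1
        exact Real.mul_rpow (e1 _) (e2 _)
  · rw [Matrix.conjTranspose_kronecker, ← Matrix.mul_kronecker_mul, hU, hV,
      Matrix.one_kronecker_one]
  · conv_lhs => rw [← hM2, ← hN2]
    rw [Matrix.mul_kronecker_mul, Matrix.mul_kronecker_mul, Matrix.conjTranspose_kronecker,
      Matrix.diagonal_kronecker_diagonal]
    simp only [Complex.ofReal_mul]

/-! ### Frobenius norm -/

/-- Squared Frobenius norm. -/
def fro {m k : Type*} [Fintype m] [Fintype k] (X : Matrix m k ℂ) : ℝ :=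
  (Matrix.trace (Xᴴ * X)).re

lemma fro_eq {m k : Type*} [Fintype m] [Fintype k] (X : Matrix m k ℂ) :
    fro X = ∑ i, ∑ j, ‖X i j‖ ^ 2 := by
  unfold fro
  simp only [Matrix.trace, Matrix.diag, Matrix.mul_apply, Matrix.conjTranspose_apply,
    Complex.re_sum]
  rw [Finset.sum_comm]
  refine Finset.sum_congr rfl fun i _ => Finset.sum_congr rfl fun j _ => ?_
  rw [← Complex.normSq_eq_norm_sq, Complex.normSq_apply]
  simp

lemma fro_nonneg {m k : Type*} [Fintype m] [Fintype k] (X : Matrix m k ℂ) : 0 ≤ fro X := by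
  rw [fro_eq]; positivity

lemma fro_conjT {m k : Type*} [Fintype m] [Fintype k] (X : Matrix m k ℂ) : fro Xᴴ = fro X := by
  rw [fro_eq, fro_eq, Finset.sum_comm]
  simp

lemma fro_eq_zero {m k : Type*} [Fintype m] [Fintype k] (X : Matrix m k ℂ) (h : fro X = 0) :
    X = 0 := by
  rw [fro_eq, Finset.sum_eq_zero_iff_of_nonneg (fun _ _ => by positivity)] at h
  ext i j
  have := h i (Finset.mem_univ i)
  rw [Finset.sum_eq_zero_iff_of_nonneg (fun _ _ => by positivity)] at this
  simpa using this j (Finset.mem_univ j)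

/-- Cauchy–Schwarz for the Hilbert–Schmidt inner product. -/
lemma trace_cs {m k : Type*} [Fintype m] [Fintype k] (X : Matrix m k ℂ) (Y : Matrix k m ℂ) :
    (Matrix.trace (X * Y)).re ^ 2 ≤ fro X * fro Y := by
  have h1 : Matrix.trace (X * Y) = ∑ p : m × k, X p.1 p.2 * Y p.2 p.1 := by
    rw [Fintype.sum_prod_type]
    simp [Matrix.trace, Matrix.mul_apply]
  have h2 : |(Matrix.trace (X * Y)).re| ≤ ∑ p : m × k, ‖X p.1 p.2‖ * ‖Y p.2 p.1‖ := by
    refine (Complex.abs_re_le_norm _).trans ?_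
    rw [h1]
    refine (norm_sum_le _ _).trans (le_of_eq ?_)
    simp
  have h3 := Finset.sum_mul_sq_le_sq_mul_sq Finset.univ
    (fun p : m × k => ‖X p.1 p.2‖) (fun p : m × k => ‖Y p.2 p.1‖)
  have h4 : fro X = ∑ p : m × k, ‖X p.1 p.2‖ ^ 2 := by
    rw [Fintype.sum_prod_type, fro_eq]
  have h5 : fro Y = ∑ p : m × k, ‖Y p.2 p.1‖ ^ 2 := by
    rw [Fintype.sum_prod_type, fro_eq, Finset.sum_comm]
  rw [h4, h5]
  refine le_trans ?_ h3
  rw [← sq_abs]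
  gcongr

/-! ### Partial trace -/

lemma ptrace2_mul_left (X : Matrix R R ℂ) (P : Matrix (R × A) (R × A) ℂ) :
    ptrace2 ((X ⊗ₖ (1 : Matrix A A ℂ)) * P) = X * ptrace2 P := by
  ext i j
  simp only [ptrace2, Matrix.of_apply, Matrix.mul_apply, Fintype.sum_prod_type,
    Matrix.kroneckerMap_apply, Matrix.one_apply, Finset.mul_sum]
  rw [Finset.sum_comm]
  simp

lemma trace_ptrace2 (P : Matrix (R × A) (R × A) ℂ) : (ptrace2 P).trace = P.trace := by
  simp [ptrace2, Matrix.trace, Fintype.sum_prod_type]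

lemma trace_mul_ptrace2 (X : Matrix R R ℂ) (P : Matrix (R × A) (R × A) ℂ) :
    (X * ptrace2 P).trace = ((X ⊗ₖ (1 : Matrix A A ℂ)) * P).trace := by
  rw [← ptrace2_mul_left, trace_ptrace2]

lemma ptrace2_conjT (P : Matrix (R × A) (R × A) ℂ) : (ptrace2 P)ᴴ = ptrace2 Pᴴ := by
  ext i j
  simp [ptrace2]

lemma ptrace2_cyc (Y : Matrix A A ℂ) (P : Matrix (R × A) (R × A) ℂ) :
    ptrace2 (((1 : Matrix R R ℂ) ⊗ₖ Y) * P) = ptrace2 (P * ((1 : Matrix R R ℂ) ⊗ₖ Y)) := by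
  ext i j
  simp only [ptrace2, Matrix.of_apply, Matrix.mul_apply, Fintype.sum_prod_type,
    Matrix.kroneckerMap_apply, Matrix.one_apply]
  simp only [ite_mul, one_mul, zero_mul, mul_ite, mul_zero]
  have h1 : ∀ a : A, (∑ x : R, ∑ x_1 : A, if i = x then Y a x_1 * P (x, x_1) (j, a) else 0)
      = ∑ b : A, Y a b * P (i, b) (j, a) := by
    intro a
    rw [Finset.sum_eq_single i] <;> simp +contextual [eq_comm]
  have h2 : ∀ a : A, (∑ x : R, ∑ x_1 : A, if x = j then P (i, a) (x, x_1) * Y x_1 a else 0)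
      = ∑ b : A, P (i, a) (j, b) * Y b a := by
    intro a
    rw [Finset.sum_eq_single j] <;> simp +contextual [eq_comm]
  simp only [h1, h2]
  rw [Finset.sum_comm]
  refine Finset.sum_congr rfl fun a _ => Finset.sum_congr rfl fun b _ => mul_comm _ _

lemma ptrace2_psd {P : Matrix (R × A) (R × A) ℂ} (hP : P.PosSemidef) :
    (ptrace2 P).PosSemidef := by
  have : ptrace2 P = ∑ a : A, P.submatrix (fun i : R => (i, a)) (fun i : R => (i, a)) := by
    ext i j
    simp [ptrace2, Matrix.sum_apply]
  rw [this]
  exact Matrix.posSemidef_sum _ fun a _ => hP.submatrix _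

/-! ### The fidelity bound -/

lemma mp_half_sq {M : Matrix d d ℂ} (hM : M.PosSemidef) :
    matPow M (1/2) * matPow M (1/2) = M := by
  rw [mp_mul hM]; norm_num [mp_one hM]

/-- A purification of `τ` adapted to the fidelity with `η`. -/
lemma exists_purif {τ η : Matrix d d ℂ} (hτ : τ.PosSemidef) (hη : η.PosSemidef)
    (hs : τ * matPow η 0 = τ) :
    ∃ (Ψ : Matrix d d ℂ) (Z : Matrix d d ℂ) (g : ℝ → Matrix d d ℂ),
      (∀ a b, g a * g b = g (a + b)) ∧ (∀ a, (g a)ᴴ = g a) ∧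
      (g (1/2)).trace.re = fidelity τ η ∧ Ψ * Ψᴴ = τ ∧ Ψᴴ * η * Ψ = g 1 ∧ Ψ * g 0 = Ψ ∧
      Ψ = τ * Z := by
  set s := matPow τ (1/2) with hsdef
  set h := matPow η (1/2) with hhdef
  have hsH : sᴴ = s := mp_herm _ _
  have hhH : hᴴ = h := mp_herm _ _
  have hss : s * s = τ := mp_half_sq hτ
  have hhh : h * h = η := mp_half_sq hη
  have hτH : τᴴ = τ := hτ.1
  set H0 := (s * h)ᴴ * (s * h) with hH0
  have hH0psd : H0.PosSemidef := Matrix.posSemidef_conjTranspose_mul_self _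
  have hH0e : H0 = h * τ * h := by
    rw [hH0, Matrix.conjTranspose_mul, hsH, hhH, ← hss]; simp only [Matrix.mul_assoc]
  have gm := mp_mul hH0psd
  have g1 : matPow H0 1 = h * τ * h := by rw [mp_one hH0psd, hH0e]
  have gh := mp_herm H0
  set g := matPow H0 with hg
  have hkh : matPow η (-(1/2)) * h = matPow η 0 := by rw [hhdef, mp_mul hη]; norm_num
  have hhk : h * matPow η (-(1/2)) = matPow η 0 := by rw [hhdef, mp_mul hη]; norm_num
  have hs' : matPow η 0 * τ = τ := by
    have := congrArg Matrix.conjTranspose hs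
    rwa [Matrix.conjTranspose_mul, mp_herm, hτH] at this
  have hΨH : (τ * h * g (-(1/2)))ᴴ = g (-(1/2)) * h * τ := by
    rw [Matrix.conjTranspose_mul, Matrix.conjTranspose_mul, gh, hhH, hτH, Matrix.mul_assoc]
  refine ⟨τ * h * g (-(1/2)), h * g (-(1/2)), g, gm, gh, ?_, ?_, ?_, ?_, ?_⟩
  · rfl
  · rw [hΨH]
    have e1 : h * (τ * h * g (-(1/2)) * (g (-(1/2)) * h * τ)) * h = h * τ * h := by
      calc h * (τ * h * g (-(1/2)) * (g (-(1/2)) * h * τ)) * h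
          = (h * τ * h) * (g (-(1/2)) * g (-(1/2))) * (h * τ * h) := by
            simp only [Matrix.mul_assoc]
        _ = h * τ * h := by rw [← g1, gm, gm, gm]; norm_num
    set W := τ * h * g (-(1/2)) * (g (-(1/2)) * h * τ) with hW
    have e2 : matPow η 0 * W = W := by
      rw [hW]; simp only [← Matrix.mul_assoc]; rw [hs']
    have e3 : W * matPow η 0 = W := by
      rw [hW]; simp only [Matrix.mul_assoc]; rw [hs]
    calc W = matPow η 0 * W * matPow η 0 := by rw [e2, e3]
      _ = matPow η (-(1/2)) * (h * W * h) * matPow η (-(1/2)) := by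
        have : matPow η (-(1/2)) * (h * W * h) * matPow η (-(1/2))
            = (matPow η (-(1/2)) * h) * W * (h * matPow η (-(1/2))) := by
          simp only [Matrix.mul_assoc]
        rw [this, hkh, hhk]
      _ = (matPow η (-(1/2)) * h) * τ * (h * matPow η (-(1/2))) := by
        rw [e1]; simp only [Matrix.mul_assoc]
      _ = τ := by rw [hkh, hhk, hs', hs]
  · rw [hΨH]
    calc g (-(1/2)) * h * τ * η * (τ * h * g (-(1/2)))
        = g (-(1/2)) * (h * τ * h) * (h * τ * h) * g (-(1/2)) := by
          rw [← hhh]; simp only [Matrix.mul_assoc]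
      _ = g 1 := by rw [← g1, gm, gm, gm]; norm_num
  · rw [Matrix.mul_assoc, gm]; norm_num
  · rw [Matrix.mul_assoc]

lemma kron1_mul (X Y : Matrix R R ℂ) :
    (X ⊗ₖ (1 : Matrix A A ℂ)) * (Y ⊗ₖ (1 : Matrix A A ℂ)) = (X * Y) ⊗ₖ (1 : Matrix A A ℂ) := by
  rw [← Matrix.mul_kronecker_mul, Matrix.one_mul]

/-- The marginal's support projection fixes the state. -/
lemma marg_supp {τ : Matrix (R × A) (R × A) ℂ} (hτ : τ.PosSemidef) :
    (matPow (ptrace2 τ) 0 ⊗ₖ (1 : Matrix A A ℂ)) * τ = τ := by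
  have hR := ptrace2_psd hτ
  have hτH : τᴴ = τ := hτ.1
  set p := matPow (ptrace2 τ) 0 with hp
  have hpp : p * p = p := by rw [hp, mp_mul hR]; norm_num
  have hpR : p * ptrace2 τ = ptrace2 τ := by
    have := mp_mul hR 0 1
    rwa [zero_add, mp_one hR] at this
  have hpH : pᴴ = p := mp_herm _ _
  have hss := mp_half_sq hτ
  have hsH := mp_herm τ (1/2)
  set s := matPow τ (1/2)
  set K := (1 - p) ⊗ₖ (1 : Matrix A A ℂ) with hK
  have hKH : Kᴴ = K := by
    rw [hK, Matrix.conjTranspose_kronecker, Matrix.conjTranspose_one, Matrix.conjTranspose_sub,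
      Matrix.conjTranspose_one, hpH]
  have h0 : s * K = 0 := by
    apply fro_eq_zero
    unfold fro
    rw [Matrix.conjTranspose_mul, hsH, hKH]
    have e1 : K * s * (s * K) = K * τ * K := by rw [← hss]; simp only [Matrix.mul_assoc]
    have e2 : (1 - p) * (1 - p) * ptrace2 τ = 0 := by
      rw [Matrix.mul_assoc, Matrix.sub_mul 1 p (ptrace2 τ), hpR, Matrix.one_mul, sub_self,
        Matrix.mul_zero]
    rw [e1, Matrix.trace_mul_comm, ← Matrix.mul_assoc, hK, kron1_mul, ← trace_mul_ptrace2, e2]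
    simp
  have h1 : K * τ = 0 := by
    have := congrArg Matrix.conjTranspose h0
    rw [Matrix.conjTranspose_mul, hsH, hKH, Matrix.conjTranspose_zero] at this
    rw [← hss, ← Matrix.mul_assoc, this, Matrix.zero_mul]
  have h2 : K = 1 - p ⊗ₖ (1 : Matrix A A ℂ) := by
    rw [eq_sub_iff_add_eq, hK, ← Matrix.add_kronecker, sub_add_cancel, Matrix.one_kronecker_one]
  rw [h2, Matrix.sub_mul, Matrix.one_mul] at h1
  exact (sub_eq_zero.mp h1).symm

set_option maxHeartbeats 1600000 in
lemma core_bound {τ : Matrix (R × A) (R × A) ℂ} (hτ : τ.PosSemidef) (hτ1 : τ.trace = 1)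
    {ω : Matrix R R ℂ} (hω : IsDensity ω) (S : ℝ → Matrix A A ℂ)
    (hSm : ∀ a b, S a * S b = S (a + b)) (hSH : ∀ a, (S a)ᴴ = S a)
    (hsupp : (matPow ω 0 ⊗ₖ S 0) * τ = τ) :
    1 ≤ fidelity τ (ptrace2 τ ⊗ₖ S 1) ^ 2 *
      (Matrix.trace (τ * (matPow ω (-(1/2)) ⊗ₖ S (-(1/2))) * τ *
        (matPow ω (-(1/2)) ⊗ₖ S (-(1/2))))).re := by
  have hR := ptrace2_psd hτ
  have hτH : τᴴ = τ := hτ.1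
  have hU1 := mp_one hR
  have hUm := mp_mul hR
  have hUH := mp_herm (ptrace2 τ)
  have hms := marg_supp hτ
  set U := matPow (ptrace2 τ) with hU
  -- support on the A side
  have hS0 : ((1 : Matrix R R ℂ) ⊗ₖ S 0) * τ = τ := by
    conv_lhs => rw [← hsupp, ← Matrix.mul_assoc, ← Matrix.mul_kronecker_mul, hSm, add_zero,
      Matrix.one_mul]
    exact hsupp
  have hUS : (U 0 ⊗ₖ S 0) * τ = τ := by
    have : U 0 ⊗ₖ S 0 = (U 0 ⊗ₖ (1 : Matrix A A ℂ)) * ((1 : Matrix R R ℂ) ⊗ₖ S 0) := by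
      rw [← Matrix.mul_kronecker_mul, Matrix.one_mul, Matrix.mul_one]
    rw [this, Matrix.mul_assoc, hS0, hms]
  set η := ptrace2 τ ⊗ₖ S 1 with hηdef
  have hη : η.PosSemidef := by
    have : η = (U (1/2) ⊗ₖ S (1/2))ᴴ * (U (1/2) ⊗ₖ S (1/2)) := by
      rw [Matrix.conjTranspose_kronecker, hUH, hSH, ← Matrix.mul_kronecker_mul, hUm, hSm]
      norm_num [hU1, hηdef]
    rw [this]
    exact Matrix.posSemidef_conjTranspose_mul_self _
  have hητ : τ * matPow η 0 = τ := by
    have e1 : τ * (U 0 ⊗ₖ S 0) = τ := by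
      have := congrArg Matrix.conjTranspose hUS
      rwa [Matrix.conjTranspose_mul, hτH, Matrix.conjTranspose_kronecker, hUH, hSH] at this
    have e2 : (U (-1) ⊗ₖ S (-1)) * η = U 0 ⊗ₖ S 0 := by
      rw [hηdef, ← Matrix.mul_kronecker_mul, hSm]
      nth_rewrite 1 [← hU1]
      rw [hUm]; norm_num
    have e3 : η * matPow η 0 = η := by
      nth_rewrite 1 [← mp_one hη]
      rw [mp_mul hη, add_zero, mp_one hη]
    conv_lhs => rw [← e1, ← e2]
    rw [Matrix.mul_assoc, Matrix.mul_assoc, e3, e2, e1]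
  obtain ⟨Ψ, Z, g, gm, gH, gF, hΨ, hΨη, hΨ0, hΨZ⟩ := exists_purif hτ hη hητ
  set F := fidelity τ η with hF
  have froF : fro (g (1/4)) = F := by
    unfold fro
    rw [gH, gm, ← gF]; norm_num
  have hF0 : 0 ≤ F := froF ▸ fro_nonneg _
  set N := ((1 : Matrix R R ℂ) ⊗ₖ S (1/2)) * Ψ * g (-(1/4)) with hN
  set J := ptrace2 (N * Ψᴴ) with hJ
  have h1H : ∀ a, ((1 : Matrix R R ℂ) ⊗ₖ S a)ᴴ = (1 : Matrix R R ℂ) ⊗ₖ S a := by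
    intro a
    rw [Matrix.conjTranspose_kronecker, Matrix.conjTranspose_one, hSH]
  have hJH : Jᴴ = J := by
    rw [hJ, ptrace2_conjT, hN]
    simp only [Matrix.conjTranspose_mul, Matrix.conjTranspose_conjTranspose, gH, h1H]
    have := ptrace2_cyc (R := R) (S (1/2)) (Ψ * g (-(1/4)) * Ψᴴ)
    simp only [Matrix.mul_assoc] at this ⊢
    exact this.symm
  have hU0Ψ : (U 0 ⊗ₖ (1 : Matrix A A ℂ)) * Ψ = Ψ := by
    rw [hΨZ, ← Matrix.mul_assoc, hms]
  have hUJ : U 0 * J = J := by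
    rw [hJ, ← ptrace2_mul_left]
    congr 1
    rw [hN]
    have : (U 0 ⊗ₖ (1 : Matrix A A ℂ)) * ((1 : Matrix R R ℂ) ⊗ₖ S (1/2))
        = ((1 : Matrix R R ℂ) ⊗ₖ S (1/2)) * (U 0 ⊗ₖ (1 : Matrix A A ℂ)) := by
      simp only [← Matrix.mul_kronecker_mul, Matrix.one_mul, Matrix.mul_one]
    simp only [← Matrix.mul_assoc]
    rw [this, Matrix.mul_assoc _ _ Ψ, hU0Ψ]
  have hJU : J * U 0 = J := by
    have := congrArg Matrix.conjTranspose hUJ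
    rwa [Matrix.conjTranspose_mul, hJH, hUH] at this
  set X := U (-(1/2)) * J * U (1/2) with hX
  have hXH : Xᴴ = U (1/2) * J * U (-(1/2)) := by
    rw [hX]
    simp only [Matrix.conjTranspose_mul, hUH, hJH, Matrix.mul_assoc]
  have hJX : fro J ≤ fro X := by
    have h1 : fro J = (Matrix.trace (X * X)).re := by
      unfold fro
      rw [hJH]
      congr 1
      have e1 : X * X = U (-(1/2)) * J * (U (1/2) * U (-(1/2))) * J * U (1/2) := by
        rw [hX]; simp only [Matrix.mul_assoc]
      have e0 : (1/2 + -(1/2) : ℝ) = 0 := by norm_num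
      rw [e1, hUm, e0, Matrix.trace_mul_comm (U (-(1/2)) * J * U 0 * J) (U (1/2))]
      simp only [← Matrix.mul_assoc]
      rw [hUm, e0, hUJ, hJU]
    have h2 := trace_cs X X
    rw [← h1] at h2
    have := fro_nonneg J
    have := fro_nonneg X
    nlinarith
  have hXL : fro X = (Matrix.trace (U (1/2) * J * U (-1) * J * U (1/2))).re := by
    unfold fro
    rw [hXH, hX]
    have : U (1/2) * J * U (-(1/2)) * (U (-(1/2)) * J * U (1/2))
      = U (1/2) * J * (U (-(1/2)) * U (-(1/2))) * J * U (1/2) := by simp only [Matrix.mul_assoc]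
    rw [this, hUm]
    norm_num
  set z := U (-1) * J * U (1/2) with hz
  have hzH : zᴴ = U (1/2) * J * U (-1) := by
    rw [hz]
    simp only [Matrix.conjTranspose_mul, hUH, hJH, Matrix.mul_assoc]
  have hfro1 : fro (Ψᴴ * (z ⊗ₖ (1 : Matrix A A ℂ))) = fro X := by
    rw [hXL]
    unfold fro
    congr 1
    rw [Matrix.conjTranspose_mul, Matrix.conjTranspose_conjTranspose,
      Matrix.conjTranspose_kronecker, Matrix.conjTranspose_one]
    have e1 : (zᴴ ⊗ₖ (1 : Matrix A A ℂ)) * Ψ * (Ψᴴ * (z ⊗ₖ (1 : Matrix A A ℂ)))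
        = (zᴴ ⊗ₖ (1 : Matrix A A ℂ)) * τ * (z ⊗ₖ (1 : Matrix A A ℂ)) := by
      rw [← hΨ]; simp only [Matrix.mul_assoc]
    rw [e1, Matrix.trace_mul_comm, ← Matrix.mul_assoc, kron1_mul, ← trace_mul_ptrace2,
      ← hU1, Matrix.mul_assoc, Matrix.trace_mul_comm, hzH, hz]
    have e2 : U (1/2) * J * U (-1) * U 1 * (U (-1) * J * U (1/2))
        = U (1/2) * J * (U (-1) * U 1 * U (-1)) * J * U (1/2) := by
      simp only [Matrix.mul_assoc]
    rw [e2, hUm, hUm]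
    norm_num
  have hfro2 : fro ((U (1/2) ⊗ₖ (1 : Matrix A A ℂ)) * N) = F := by
    rw [← gF]
    unfold fro
    congr 2
    rw [hN]
    simp only [Matrix.conjTranspose_mul, gH, h1H, Matrix.conjTranspose_kronecker,
      Matrix.conjTranspose_one, hUH]
    have e1 : ((1 : Matrix R R ℂ) ⊗ₖ S (1/2)) * (U (1/2) ⊗ₖ (1 : Matrix A A ℂ)) *
        (U (1/2) ⊗ₖ (1 : Matrix A A ℂ)) * ((1 : Matrix R R ℂ) ⊗ₖ S (1/2)) = η := by
      simp only [← Matrix.mul_kronecker_mul, Matrix.one_mul, Matrix.mul_one]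
      rw [hUm, hSm, hηdef]
      norm_num [hU1]
    calc _ = g (-(1/4)) * (Ψᴴ * (((1 : Matrix R R ℂ) ⊗ₖ S (1/2)) *
          (U (1/2) ⊗ₖ (1 : Matrix A A ℂ)) *
          (U (1/2) ⊗ₖ (1 : Matrix A A ℂ)) * ((1 : Matrix R R ℂ) ⊗ₖ S (1/2))) * Ψ) *
          g (-(1/4)) := by
            simp only [Matrix.mul_assoc]
      _ = g (1/2) := by rw [e1, hΨη, gm, gm]; norm_num
  have hXF : fro X ≤ F := by
    have h1 : fro X = (Matrix.trace ((Ψᴴ * (z ⊗ₖ (1 : Matrix A A ℂ))) *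
        ((U (1/2) ⊗ₖ (1 : Matrix A A ℂ)) * N))).re := by
      rw [hXL]
      congr 1
      have e1 : Ψᴴ * (z ⊗ₖ (1 : Matrix A A ℂ)) * ((U (1/2) ⊗ₖ (1 : Matrix A A ℂ)) * N)
          = Ψᴴ * (((z * U (1/2)) ⊗ₖ (1 : Matrix A A ℂ)) * N) := by
        rw [← kron1_mul z]; simp only [Matrix.mul_assoc]
      rw [e1, Matrix.trace_mul_comm Ψᴴ, Matrix.mul_assoc _ N, ← trace_mul_ptrace2, ← hJ,
        Matrix.trace_mul_comm _ J, hz]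
      have e2 : J * (U (-1) * J * U (1/2) * U (1/2)) = (J * U (-1) * J * U (1/2)) * U (1/2) := by
        simp only [Matrix.mul_assoc]
      rw [e2, Matrix.trace_mul_comm (J * U (-1) * J * U (1/2)) (U (1/2))]
      simp only [Matrix.mul_assoc]
    have h2 := trace_cs (Ψᴴ * (z ⊗ₖ (1 : Matrix A A ℂ))) ((U (1/2) ⊗ₖ (1 : Matrix A A ℂ)) * N)
    rw [← h1, hfro1, hfro2] at h2
    have := fro_nonneg X
    by_contra hc
    push Not at hc
    nlinarith
  -- the operators on the reference state side
  have hωm := mp_mul hω.1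
  have hωH := mp_herm ω
  set T : ℝ → Matrix (R × A) (R × A) ℂ := fun r => matPow ω r ⊗ₖ S r with hT
  have hTm : ∀ a b, T a * T b = T (a + b) := by
    intro a b
    simp only [hT]
    rw [← Matrix.mul_kronecker_mul, hωm, hSm]
  have hTH : ∀ a, (T a)ᴴ = T a := by
    intro a
    simp only [hT]
    rw [Matrix.conjTranspose_kronecker, hωH, hSH]
  change T 0 * τ = τ at hsupp
  change 1 ≤ F ^ 2 * (Matrix.trace (τ * T (-(1/2)) * τ * T (-(1/2)))).re
  set Q := (Matrix.trace (τ * T (-(1/2)) * τ * T (-(1/2)))).re with hQ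
  set a2 := fro (T (1/4) * Ψ * g (-(1/8))) with ha2
  set b2 := fro (g (1/8) * Ψᴴ * T (-(1/4))) with hb2
  have hab : 1 ≤ a2 * b2 := by
    have := trace_cs (T (1/4) * Ψ * g (-(1/8))) (g (1/8) * Ψᴴ * T (-(1/4)))
    have e1 : (T (1/4) * Ψ * g (-(1/8))) * (g (1/8) * Ψᴴ * T (-(1/4)))
        = T (1/4) * ((Ψ * (g (-(1/8)) * g (1/8))) * Ψᴴ) * T (-(1/4)) := by
      simp only [Matrix.mul_assoc]
    have e2 : Matrix.trace ((T (1/4) * Ψ * g (-(1/8))) * (g (1/8) * Ψᴴ * T (-(1/4)))) = 1 := by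
      rw [e1, gm, neg_add_cancel, hΨ0, hΨ, Matrix.trace_mul_comm, ← Matrix.mul_assoc, hTm,
        neg_add_cancel, hsupp, hτ1]
    rw [e2, Complex.one_re, one_pow] at this
    exact this
  have ha : a2 ^ 2 ≤ F := by
    have e1 : a2 = (Matrix.trace (matPow ω (1/2) * J)).re := by
      rw [ha2]
      unfold fro
      congr 1
      rw [hJ, trace_mul_ptrace2, hN]
      simp only [Matrix.conjTranspose_mul, gH, hTH]
      have e3 : T (1/2) = (matPow ω (1/2) ⊗ₖ (1 : Matrix A A ℂ)) *
          ((1 : Matrix R R ℂ) ⊗ₖ S (1/2)) := by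
        simp only [hT]
        rw [← Matrix.mul_kronecker_mul, Matrix.one_mul, Matrix.mul_one]
      have e4 : g (-(1/8)) * (Ψᴴ * T (1/4)) * (T (1/4) * Ψ * g (-(1/8)))
          = (g (-(1/8)) * Ψᴴ) * ((T (1/4) * T (1/4)) * Ψ * g (-(1/8))) := by
        simp only [Matrix.mul_assoc]
      rw [e4, Matrix.trace_mul_comm, hTm]
      have e5 : T (1/4 + 1/4) * Ψ * g (-(1/8)) * (g (-(1/8)) * Ψᴴ)
          = T (1/4 + 1/4) * Ψ * (g (-(1/8)) * g (-(1/8))) * Ψᴴ := by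
        simp only [Matrix.mul_assoc]
      have e6 : (1/4 + 1/4 : ℝ) = 1/2 := by norm_num
      have e7 : (-(1/8) + -(1/8) : ℝ) = -(1/4) := by norm_num
      rw [e5, gm, e6, e7, e3]
      simp only [Matrix.mul_assoc]
    have h2 := trace_cs (matPow ω (1/2)) J
    have e2 : fro (matPow ω (1/2)) = 1 := by
      unfold fro
      rw [hωH, mp_half_sq hω.1, hω.2]; rfl
    rw [← e1, e2, one_mul] at h2
    linarith
  have hb : b2 ^ 2 ≤ Q * F := by
    have e1 : b2 = (Matrix.trace ((Ψᴴ * T (-(1/2)) * Ψ) * g (1/4))).re := by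
      rw [hb2]
      unfold fro
      congr 1
      simp only [Matrix.conjTranspose_mul, Matrix.conjTranspose_conjTranspose, gH, hTH]
      have e3 : T (-(1/4)) * (Ψ * g (1/8)) * (g (1/8) * Ψᴴ * T (-(1/4)))
          = T (-(1/4)) * (Ψ * (g (1/8) * g (1/8)) * Ψᴴ * T (-(1/4))) := by
        simp only [Matrix.mul_assoc]
      have e4 : (1/8 + 1/8 : ℝ) = 1/4 := by norm_num
      have e5 : (-(1/4) + -(1/4) : ℝ) = -(1/2) := by norm_num
      rw [e3, Matrix.trace_mul_comm, Matrix.mul_assoc _ _ (T (-(1/4))), hTm, gm, e4, e5,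
        Matrix.mul_assoc, Matrix.mul_assoc Ψ, Matrix.trace_mul_comm, Matrix.mul_assoc,
        Matrix.trace_mul_comm]
    have h2 := trace_cs (Ψᴴ * T (-(1/2)) * Ψ) (g (1/4))
    have e2 : fro (Ψᴴ * T (-(1/2)) * Ψ) = Q := by
      rw [hQ]
      unfold fro
      congr 1
      simp only [Matrix.conjTranspose_mul, Matrix.conjTranspose_conjTranspose, hTH]
      have e3 : Ψᴴ * (T (-(1/2)) * Ψ) * (Ψᴴ * T (-(1/2)) * Ψ)
          = Ψᴴ * (T (-(1/2)) * (Ψ * Ψᴴ) * T (-(1/2)) * Ψ) := by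
        simp only [Matrix.mul_assoc]
      rw [e3, Matrix.trace_mul_comm, Matrix.mul_assoc _ Ψ, hΨ, Matrix.trace_mul_comm]
      simp only [Matrix.mul_assoc]
    rw [← e1, e2, froF] at h2
    exact h2
  have ha0 : 0 ≤ a2 := fro_nonneg _
  have hb0 : 0 ≤ b2 := fro_nonneg _
  calc (1 : ℝ) ≤ (a2 * b2) ^ 2 := by nlinarith
    _ = a2 ^ 2 * b2 ^ 2 := by ring
    _ ≤ F * (Q * F) := mul_le_mul ha hb (sq_nonneg b2) hF0
    _ = F ^ 2 * Q := by ring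

/-! ### Tensor products over `Fin n` -/

/-- Tensor product of a family of matrices. -/
def pten {n : ℕ} (f : Fin n → Matrix A A ℂ) : Matrix (Fin n → A) (Fin n → A) ℂ :=
  Matrix.of fun v w => ∏ k, f k (v k) (w k)

lemma pten_mul {n : ℕ} (f g : Fin n → Matrix A A ℂ) :
    pten f * pten g = pten (fun k => f k * g k) := by
  ext v w
  simp only [pten, Matrix.mul_apply, Matrix.of_apply]
  rw [Finset.prod_univ_sum, Fintype.piFinset_univ]
  exact Finset.sum_congr rfl fun x _ => Finset.prod_mul_distrib.symm

lemma pten_trace {n : ℕ} (f : Fin n → Matrix A A ℂ) :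
    (pten f).trace = ∏ k, (f k).trace := by
  simp only [pten, Matrix.trace, Matrix.diag, Matrix.of_apply]
  rw [Finset.prod_univ_sum, Fintype.piFinset_univ]

lemma tauX_add (P P' : Matrix (R × A) (R × A) ℂ) (a : Matrix A A ℂ) (n : ℕ) (x : Fin n) :
    tauX (P + P') a n x = tauX P a n x + tauX P' a n x := by
  ext p q
  simp [tauX, add_mul]

lemma tauX_zero (a : Matrix A A ℂ) (n : ℕ) (x : Fin n) :
    tauX (0 : Matrix (R × A) (R × A) ℂ) a n x = 0 := by
  ext p q
  simp [tauX]

lemma tauX_kron (B : Matrix R R ℂ) (C a : Matrix A A ℂ) (n : ℕ) (x : Fin n) :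
    tauX (B ⊗ₖ C) a n x = B ⊗ₖ pten (Function.update (fun _ => a) x C) := by
  ext p q
  simp only [tauX, pten, Matrix.of_apply, Matrix.kroneckerMap_apply]
  rw [← Finset.mul_prod_erase _ _ (Finset.mem_univ x), Function.update_self, mul_assoc]
  congr 2
  refine Finset.prod_congr rfl fun k hk => ?_
  rw [Function.update_of_ne (Finset.ne_of_mem_erase hk)]

lemma tauX_tpow (B : Matrix R R ℂ) (a : Matrix A A ℂ) (n : ℕ) (x : Fin n) :
    B ⊗ₖ tpow a n = tauX (B ⊗ₖ a) a n x := by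
  rw [tauX_kron, Function.update_eq_self_iff.mpr rfl]
  rfl

/-- Induction over sums of product matrices. -/
lemma kron_induction (p : Matrix (R × A) (R × A) ℂ → Prop) (h0 : p 0)
    (hadd : ∀ P P', p P → p P' → p (P + P')) (hk : ∀ B C, p (B ⊗ₖ C))
    (P : Matrix (R × A) (R × A) ℂ) : p P := by
  refine Matrix.induction_on' P h0 hadd ?_
  rintro ⟨i, k⟩ ⟨j, l⟩ c
  have : Matrix.single (i, k) (j, l) c = Matrix.single i j c ⊗ₖ Matrix.single k l (1 : ℂ) := by
    rw [Matrix.single_kronecker_single, mul_one]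
  rw [this]
  exact hk _ _

lemma tauX_mul (P P' : Matrix (R × A) (R × A) ℂ) (a b : Matrix A A ℂ) (n : ℕ) (x : Fin n) :
    tauX P a n x * tauX P' b n x = tauX (P * P') (a * b) n x := by
  induction P using kron_induction with
  | h0 => simp [tauX_zero]
  | hadd P1 P2 h1 h2 => simp [tauX_add, add_mul, h1, h2]
  | hk B C =>
    induction P' using kron_induction with
    | h0 => simp [tauX_zero]
    | hadd P1 P2 h1 h2 => simp [tauX_add, mul_add, h1, h2]
    | hk B' C' =>
      rw [← Matrix.mul_kronecker_mul]
      simp only [tauX_kron]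
      rw [← Matrix.mul_kronecker_mul, pten_mul]
      congr 2
      ext k : 1
      by_cases h : k = x
      · subst h; simp
      · simp [h]

lemma ptrace2_add (P P' : Matrix (R × A) (R × A) ℂ) :
    ptrace2 (P + P') = ptrace2 P + ptrace2 P' := by
  ext i j
  simp [ptrace2, Finset.sum_add_distrib]

lemma ptrace2_zero : ptrace2 (0 : Matrix (R × A) (R × A) ℂ) = 0 := by
  ext i j
  simp [ptrace2]

lemma ptrace2_smul (c : ℂ) (P : Matrix (R × A) (R × A) ℂ) :
    ptrace2 (c • P) = c • ptrace2 P := by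
  ext i j
  simp [ptrace2, Finset.mul_sum]

lemma ptrace2_kron (B : Matrix R R ℂ) (C : Matrix A A ℂ) : ptrace2 (B ⊗ₖ C) = C.trace • B := by
  ext i j
  simp only [ptrace2, Matrix.of_apply, Matrix.kroneckerMap_apply, ← Finset.mul_sum,
    Matrix.smul_apply, smul_eq_mul]
  rw [mul_comm]; rfl

lemma prod_update_one {n : ℕ} (x : Fin n) (f : Fin n → ℂ) (h : ∀ k, k ≠ x → f k = 1) :
    ∏ k, f k = f x := Fintype.prod_eq_single x h

lemma ptrace2_tauX (P : Matrix (R × A) (R × A) ℂ) (a : Matrix A A ℂ) (ha : a.trace = 1)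
    (n : ℕ) (x : Fin n) : ptrace2 (tauX P a n x) = ptrace2 P := by
  induction P using kron_induction with
  | h0 => simp [tauX_zero, ptrace2_zero]
  | hadd P1 P2 h1 h2 => simp [tauX_add, ptrace2_add, h1, h2]
  | hk B C =>
    rw [tauX_kron, ptrace2_kron, ptrace2_kron, pten_trace, prod_update_one x]
    · simp
    · intro k hk; simp [hk, ha]

lemma trace_tauX_self (P P' : Matrix (R × A) (R × A) ℂ) (a b : Matrix A A ℂ)
    (hab : (a * b).trace = 1) (n : ℕ) (x : Fin n) :
    (tauX P a n x * tauX P' b n x).trace = (P * P').trace := by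
  rw [tauX_mul, ← trace_ptrace2, ptrace2_tauX _ _ hab, trace_ptrace2]

lemma trace_tauX_ne (P P' : Matrix (R × A) (R × A) ℂ) (a b : Matrix A A ℂ)
    (hab : (a * b).trace = 1) (n : ℕ) (x y : Fin n) (hxy : x ≠ y) :
    (tauX P a n x * tauX P' b n y).trace =
      (ptrace2 (P * ((1 : Matrix R R ℂ) ⊗ₖ b)) *
        ptrace2 (((1 : Matrix R R ℂ) ⊗ₖ a) * P')).trace := by
  induction P using kron_induction with
  | h0 => simp [tauX_zero, ptrace2_zero]
  | hadd P1 P2 h1 h2 => simp [tauX_add, add_mul, h1, h2, ptrace2_add]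
  | hk B C =>
    induction P' using kron_induction with
    | h0 => simp [tauX_zero, ptrace2_zero]
    | hadd P1 P2 h1 h2 => simp [tauX_add, mul_add, h1, h2, ptrace2_add]
    | hk B' C' =>
      simp only [tauX_kron, ← Matrix.mul_kronecker_mul, ptrace2_kron, pten_mul,
        Matrix.trace_kronecker, pten_trace, Matrix.mul_one, Matrix.one_mul, Matrix.smul_mul,
        Matrix.mul_smul, Matrix.trace_smul, smul_eq_mul]
      rw [Fintype.prod_eq_mul x y hxy]
      · simp only [Function.update_self, Function.update_of_ne hxy, Function.update_of_ne hxy.symm]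
        ring
      · rintro k ⟨h1, h2⟩
        simp [h1, h2, hab]

lemma tauX_conjT (P : Matrix (R × A) (R × A) ℂ) (a : Matrix A A ℂ) (n : ℕ) (x : Fin n) :
    (tauX P a n x)ᴴ = tauX Pᴴ aᴴ n x := by
  ext p q
  simp [tauX]

lemma tauX_psd {P : Matrix (R × A) (R × A) ℂ} {a : Matrix A A ℂ} (hP : P.PosSemidef)
    (ha : a.PosSemidef) (n : ℕ) (x : Fin n) : (tauX P a n x).PosSemidef := by
  have : tauX P a n x = (tauX (matPow P (1/2)) (matPow a (1/2)) n x)ᴴ *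
      tauX (matPow P (1/2)) (matPow a (1/2)) n x := by
    rw [tauX_conjT, mp_herm, mp_herm, tauX_mul, mp_half_sq hP, mp_half_sq ha]
  rw [this]
  exact Matrix.posSemidef_conjTranspose_mul_self _

lemma tpow_mul (a b : Matrix A A ℂ) (n : ℕ) : tpow a n * tpow b n = tpow (a * b) n :=
  pten_mul (fun _ => a) (fun _ => b)

lemma tpow_conjT (a : Matrix A A ℂ) (n : ℕ) : (tpow a n)ᴴ = tpow aᴴ n := by
  ext p q
  simp [tpow]

/-- The collision quantity of the convex split state. -/
lemma Q_split (n : ℕ) (hn : 0 < n) (ρ : Matrix (R × A) (R × A) ℂ) (hρ : IsDensity ρ)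
    (σ : Matrix A A ℂ) (hσ : IsDensity σ) (X : Matrix R R ℂ)
    (hs : ((1 : Matrix R R ℂ) ⊗ₖ matPow σ 0) * ρ = ρ) :
    (((n : ℂ)⁻¹ • ∑ x : Fin n, tauX ρ σ n x) * (X ⊗ₖ tpow (matPow σ (-(1/2))) n) *
      ((n : ℂ)⁻¹ • ∑ x : Fin n, tauX ρ σ n x) * (X ⊗ₖ tpow (matPow σ (-(1/2))) n)).trace
    = (((n : ℂ) - 1) / n) * (ptrace2 ρ * X * ptrace2 ρ * X).trace
      + (1 / (n : ℂ)) * (ρ * (X ⊗ₖ matPow σ (-(1/2))) * ρ * (X ⊗ₖ matPow σ (-(1/2)))).trace := by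
  have hσm := mp_mul hσ.1
  have hσ1 := mp_one hσ.1
  have hρH : ρᴴ = ρ := hρ.1.1
  have hs' : ρ * ((1 : Matrix R R ℂ) ⊗ₖ matPow σ 0) = ρ := by
    have := congrArg Matrix.conjTranspose hs
    rwa [Matrix.conjTranspose_mul, hρH, Matrix.conjTranspose_kronecker, mp_herm,
      Matrix.conjTranspose_one] at this
  set Y := matPow σ (-(1/2)) with hY
  set P := ρ * (X ⊗ₖ Y) with hP
  have hYY : Y * (σ * Y) = matPow σ 0 := by
    nth_rewrite 1 [← hσ1]
    rw [hY, hσm, hσm]; norm_num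
  have hYY2 : (σ * Y) * (σ * Y) = σ := by
    nth_rewrite 1 [← hσ1]
    nth_rewrite 2 [← hσ1]
    nth_rewrite 3 [← hσ1]
    rw [hY, hσm, hσm]; norm_num
  have htr : ((σ * Y) * (σ * Y)).trace = 1 := by rw [hYY2, hσ.2]
  have h1 : ((n : ℂ)⁻¹ • ∑ x : Fin n, tauX ρ σ n x) * (X ⊗ₖ tpow Y n)
      = (n : ℂ)⁻¹ • ∑ x : Fin n, tauX P (σ * Y) n x := by
    rw [Matrix.smul_mul, Finset.sum_mul]
    congr 1
    refine Finset.sum_congr rfl fun x _ => ?_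
    rw [tauX_tpow X Y n x, tauX_mul]
  have hpt : ptrace2 (ρ * (X ⊗ₖ (1 : Matrix A A ℂ))) = ptrace2 ρ * X := by
    have := ptrace2_mul_left (A := A) Xᴴ ρ
    have := congrArg Matrix.conjTranspose this
    rw [ptrace2_conjT, Matrix.conjTranspose_mul, hρH, Matrix.conjTranspose_kronecker,
      Matrix.conjTranspose_conjTranspose, Matrix.conjTranspose_one, Matrix.conjTranspose_mul,
      ptrace2_conjT, hρH, Matrix.conjTranspose_conjTranspose] at this
    exact this
  have hpi : ρ * (X ⊗ₖ matPow σ 0) = ρ * (X ⊗ₖ (1 : Matrix A A ℂ)) := by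
    conv_rhs => rw [← hs']
    rw [Matrix.mul_assoc, ← Matrix.mul_kronecker_mul, Matrix.one_mul, Matrix.mul_one]
  have hA : ptrace2 (P * ((1 : Matrix R R ℂ) ⊗ₖ (σ * Y))) = ptrace2 ρ * X := by
    rw [hP, Matrix.mul_assoc, ← Matrix.mul_kronecker_mul, hYY, Matrix.mul_one, hpi, hpt]
  have hB : ptrace2 (((1 : Matrix R R ℂ) ⊗ₖ (σ * Y)) * P) = ptrace2 ρ * X := by
    rw [ptrace2_cyc, hA]
  have hterm : ∀ x y : Fin n, (tauX P (σ * Y) n x * tauX P (σ * Y) n y).trace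
      = (ptrace2 ρ * X * ptrace2 ρ * X).trace +
        if x = y then (P * P).trace - (ptrace2 ρ * X * ptrace2 ρ * X).trace else 0 := by
    intro x y
    by_cases h : x = y
    · subst h
      rw [trace_tauX_self _ _ _ _ htr]; simp
    · rw [trace_tauX_ne _ _ _ _ htr n x y h, hA, hB, if_neg h, add_zero, Matrix.mul_assoc _ _ X,
        ← Matrix.mul_assoc]
  rw [Matrix.mul_assoc (_ * _), h1, Matrix.smul_mul, Matrix.mul_smul, Matrix.trace_smul,
    Matrix.trace_smul, Finset.sum_mul_sum, Matrix.trace_sum]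
  simp only [Matrix.trace_sum, hterm]
  have hPP : ρ * (X ⊗ₖ Y) * ρ * (X ⊗ₖ Y) = P * P := by
    rw [hP]; simp only [Matrix.mul_assoc]
  rw [hPP]
  simp only [Finset.sum_add_distrib, Finset.sum_const, Finset.card_univ, Fintype.card_fin,
    Finset.sum_ite_eq, Finset.mem_univ, if_true, nsmul_eq_mul, smul_eq_mul]
  have hn0 : (n : ℂ) ≠ 0 := by exact_mod_cast hn.ne'
  field_simp
  ring

lemma split_bound (n : ℕ) (hn : 0 < n)
    (ρ : Matrix (R × A) (R × A) ℂ) (hρ : IsDensity ρ)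
    (σ : Matrix A A ℂ) (hσ : IsDensity σ) (ω : Matrix R R ℂ) (hω : IsDensity ω)
    (hsup : suppLE ρ (ω ⊗ₖ σ)) :
    1 ≤ fidelity ((n : ℂ)⁻¹ • ∑ x : Fin n, tauX ρ σ n x) (ptrace2 ρ ⊗ₖ tpow σ n) ^ 2 *
      ((((n : ℝ) - 1) / n) * Q2R (ptrace2 ρ) ω + (1 / (n : ℝ)) * Q2R ρ (ω ⊗ₖ σ)) := by
  have hn0 : (n : ℂ) ≠ 0 := by exact_mod_cast hn.ne'
  have hρH : ρᴴ = ρ := hρ.1.1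
  have hωm := mp_mul hω.1
  have hσm := mp_mul hσ.1
  -- support
  have hs1 : ρ * (matPow ω 0 ⊗ₖ matPow σ 0) = ρ := by
    have e1 : (ω ⊗ₖ σ) * (1 - matPow ω 0 ⊗ₖ matPow σ 0) = 0 := by
      have f1 := hωm 1 0
      have f2 := hσm 1 0
      rw [add_zero, mp_one hω.1] at f1
      rw [add_zero, mp_one hσ.1] at f2
      rw [Matrix.mul_sub, Matrix.mul_one, ← Matrix.mul_kronecker_mul, f1, f2, sub_self]
    have e2 : ρ * (1 - matPow ω 0 ⊗ₖ matPow σ 0) = 0 := by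
      ext i j
      have h1 : (1 - matPow ω 0 ⊗ₖ matPow σ 0).col j ∈ LinearMap.ker (ω ⊗ₖ σ).mulVecLin := by
        rw [LinearMap.mem_ker]
        ext k
        exact congrFun (congrFun e1 k) j
      have h2 := hsup h1
      rw [LinearMap.mem_ker] at h2
      exact congrFun h2 i
    rw [Matrix.mul_sub, Matrix.mul_one] at e2
    exact (sub_eq_zero.mp e2).symm
  have hs2 : (matPow ω 0 ⊗ₖ matPow σ 0) * ρ = ρ := by
    have := congrArg Matrix.conjTranspose hs1
    rwa [Matrix.conjTranspose_mul, hρH, Matrix.conjTranspose_kronecker, mp_herm, mp_herm] at this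
  have hs3 : ((1 : Matrix R R ℂ) ⊗ₖ matPow σ 0) * ρ = ρ := by
    conv_lhs => rw [← hs2, ← Matrix.mul_assoc, ← Matrix.mul_kronecker_mul, hσm, add_zero,
      Matrix.one_mul]
    exact hs2
  have hQ := Q_split n hn ρ hρ σ hσ (matPow ω (-(1/2))) hs3
  set τ := (n : ℂ)⁻¹ • ∑ x : Fin n, tauX ρ σ n x with hτdef
  have hpt : ptrace2 τ = ptrace2 ρ := by
    have hsum : ptrace2 (∑ x : Fin n, tauX ρ σ n x) = ∑ x : Fin n, ptrace2 (tauX ρ σ n x) := by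
      ext i j
      simp only [ptrace2, Matrix.of_apply, Matrix.sum_apply]
      exact Finset.sum_comm
    rw [hτdef, ptrace2_smul, hsum]
    simp only [ptrace2_tauX _ _ hσ.2, Finset.sum_const, Finset.card_univ, Fintype.card_fin]
    rw [← Nat.cast_smul_eq_nsmul ℂ, smul_smul, inv_mul_cancel₀ hn0, one_smul]
  have hτ : τ.PosSemidef := by
    rw [hτdef]
    refine (Matrix.posSemidef_sum _ fun x _ => tauX_psd hρ.1 hσ.1 n x).smul ?_
    rw [← Complex.ofReal_natCast, ← Complex.ofReal_inv]
    exact Complex.zero_le_real.mpr (by positivity)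
  have hτ1 : τ.trace = 1 := by
    rw [← trace_ptrace2, hpt, trace_ptrace2, hρ.2]
  have hsupp : (matPow ω 0 ⊗ₖ tpow (matPow σ 0) n) * τ = τ := by
    rw [hτdef, Matrix.mul_smul, Finset.mul_sum]
    congr 1
    refine Finset.sum_congr rfl fun x _ => ?_
    have f2 := hσm 0 1
    rw [zero_add, mp_one hσ.1] at f2
    rw [tauX_tpow _ _ n x, tauX_mul, hs2, f2]
  have key := core_bound hτ hτ1 hω (fun r => tpow (matPow σ r) n)
    (fun a b => by rw [tpow_mul, hσm]) (fun a => by rw [tpow_conjT, mp_herm]) hsupp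
  rw [hpt] at key
  simp only [mp_one hσ.1] at key
  rw [hQ] at key
  have hre : ((((n : ℂ) - 1) / n) * (ptrace2 ρ * matPow ω (-(1/2)) * ptrace2 ρ *
      matPow ω (-(1/2))).trace
      + (1 / (n : ℂ)) * (ρ * (matPow ω (-(1/2)) ⊗ₖ matPow σ (-(1/2))) * ρ *
        (matPow ω (-(1/2)) ⊗ₖ matPow σ (-(1/2)))).trace).re
      = (((n : ℝ) - 1) / n) * Q2R (ptrace2 ρ) ω + (1 / (n : ℝ)) * Q2R ρ (ω ⊗ₖ σ) := by
    have c1 : (((n : ℂ) - 1) / n) = (((((n : ℝ) - 1) / n : ℝ)) : ℂ) := by push_cast; rfl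
    have c2 : (1 / (n : ℂ)) = ((1 / (n : ℝ) : ℝ) : ℂ) := by push_cast; rfl
    rw [c1, c2, Complex.add_re, Complex.re_ofReal_mul, Complex.re_ofReal_mul]
    unfold Q2R
    rw [mp_kron hω.1 hσ.1]
  rw [hre] at key
  exact key

/-- **Purified-distance bound from the convex split lemma** (Corollary 1):
`P²(τ, ρ^R ⊗ σ^{⊗n}) ≤ 1 − 1/ν_n`, where
`ν_n = min_ω [((n−1)/n)·Q₂(ρ^R‖ω) + (1/n)·Q₂(ρ^{RA}‖ω⊗σ)]`. -/
theorem convex_split_purified_distance (n : ℕ) (hn : 0 < n)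
    (ρ : Matrix (R × A) (R × A) ℂ) (hρ : IsDensity ρ)
    (σ : Matrix A A ℂ) (hσ : IsDensity σ) :
    ENNReal.ofReal
        (purifiedDist ((n : ℂ)⁻¹ • ∑ x : Fin n, tauX ρ σ n x) (ptrace2 ρ ⊗ₖ tpow σ n) ^ 2)
      ≤ 1 - 1 / (⨅ ω : {ω : Matrix R R ℂ // IsDensity ω},
          (((n : ℝ≥0∞) - 1) / n) * Q2 (ptrace2 ρ) ω.1
            + (1 / (n : ℝ≥0∞)) * Q2 ρ (ω.1 ⊗ₖ σ)) := by
  set F := fidelity ((n : ℂ)⁻¹ • ∑ x : Fin n, tauX ρ σ n x) (ptrace2 ρ ⊗ₖ tpow σ n) with hF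
  have hnR : (0 : ℝ) < n := by exact_mod_cast hn
  have hn1 : (1 : ℝ) ≤ n := by exact_mod_cast hn
  have hP : purifiedDist ((n : ℂ)⁻¹ • ∑ x : Fin n, tauX ρ σ n x) (ptrace2 ρ ⊗ₖ tpow σ n) ^ 2
      ≤ max (1 - F ^ 2) 0 := by
    unfold purifiedDist
    rw [← hF]
    by_cases h : 0 ≤ 1 - F ^ 2
    · rw [Real.sq_sqrt h]; exact le_max_left _ _
    · rw [Real.sqrt_eq_zero_of_nonpos (le_of_not_ge h)]; simp
  refine (ENNReal.ofReal_le_ofReal hP).trans ?_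
  have hmax : ENNReal.ofReal (max (1 - F ^ 2) 0) = 1 - ENNReal.ofReal (F ^ 2) := by
    rw [← ENNReal.ofReal_one, ← ENNReal.ofReal_sub _ (sq_nonneg F)]
    rcases le_total 0 (1 - F ^ 2) with h | h
    · rw [max_eq_left h]
    · rw [max_eq_right h, ENNReal.ofReal_of_nonpos h, ENNReal.ofReal_zero]
  rw [hmax]
  refine tsub_le_tsub_left ?_ 1
  rw [one_div, ENNReal.inv_iInf]
  refine iSup_le fun ω => ?_
  by_cases hs : suppLE ρ (ω.1 ⊗ₖ σ)
  · have hb := split_bound n hn ρ hρ σ hσ ω.1 ω.2 hs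
    rw [← hF] at hb
    set q1 := Q2R (ptrace2 ρ) ω.1 with hq1
    set q2 := Q2R ρ (ω.1 ⊗ₖ σ) with hq2
    set q := (((n : ℝ) - 1) / n) * q1 + (1 / (n : ℝ)) * q2 with hq
    have hqpos : 0 < q := by
      by_contra h
      push Not at h
      nlinarith [sq_nonneg F]
    have hle : ENNReal.ofReal q ≤ (((n : ℝ≥0∞) - 1) / n) * Q2 (ptrace2 ρ) ω.1
            + (1 / (n : ℝ≥0∞)) * Q2 ρ (ω.1 ⊗ₖ σ) := by
      rw [hq]
      refine ENNReal.ofReal_add_le.trans ?_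
      have c1 : ENNReal.ofReal (((n : ℝ) - 1) / n) = ((n : ℝ≥0∞) - 1) / n := by
        rw [ENNReal.ofReal_div_of_pos hnR, ENNReal.ofReal_sub _ zero_le_one,
          ENNReal.ofReal_natCast, ENNReal.ofReal_one]
      have c2 : ENNReal.ofReal (1 / (n : ℝ)) = 1 / (n : ℝ≥0∞) := by
        rw [ENNReal.ofReal_div_of_pos hnR, ENNReal.ofReal_natCast, ENNReal.ofReal_one]
      rw [ENNReal.ofReal_mul (div_nonneg (by linarith) hnR.le),
        ENNReal.ofReal_mul (by positivity), c1, c2]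
      gcongr
      · unfold Q2
        split_ifs
        · exact le_rfl
        · exact le_top
      · unfold Q2
        rw [if_pos hs]
    refine (ENNReal.inv_le_inv.mpr hle).trans ?_
    rw [← ENNReal.ofReal_inv_of_pos hqpos]
    apply ENNReal.ofReal_le_ofReal
    rw [inv_le_iff_one_le_mul₀ hqpos]
    exact hb
  · have : Q2 ρ (ω.1 ⊗ₖ σ) = ∞ := by unfold Q2; rw [if_neg hs]
    rw [this, ENNReal.mul_top (by simp)]
    simp
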